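/- arXiv:2203.10061 — 4 statements merged into one kernel-verified Lean document; each statement's English description precedes it below -/
import Mathlib

section
/- Let N_S, N_F be positive integers, ρ_F > 0 a real number, M_S, K_S, D_S real symmetric N_S×N_S matrices, M_F, K_F real symmetric N_F×N_F matrices with D_S positive semidefinite, and R an arbitrary real N_S×N_F matrix. Define the block matrices E = blockdiag(I_{N_S}, I_{N_F}, M_S, M_F/ρ_F), Q = blockdiag(K_S, K_F, I_{N_S}, I_{N_F}), D = blockdiag(0, 0, D_S, 0), and J = [[0,0,I_{N_S},0],[0,0,0,I_{N_F}],[−I_{N_S},0,0,R],[0,−I_{N_F},−Rᵀ,0]]. Then these matrices satisfy the three port-Hamiltonian structure properties: J = −Jᵀ, D = Dᵀ ≥ 0 (symmetric positive semidefinite), and EᵀQ = QᵀE. -/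
open Matrix

/-- A block diagonal matrix with positive semidefinite diagonal blocks is positive semidefinite. -/
theorem posSemidef_fromBlocks_diagonal {m n : Type*} [Fintype m] [Fintype n]
    {A : Matrix m m ℝ} {B : Matrix n n ℝ} (hA : A.PosSemidef) (hB : B.PosSemidef) :
    (fromBlocks A 0 0 B).PosSemidef := by
  refine PosSemidef.of_dotProduct_mulVec_nonneg ?_ fun x => ?_
  · exact hA.isHermitian.fromBlocks (by simp) hB.isHermitian
  · have h₁ := hA.dotProduct_mulVec_nonneg (x ∘ Sum.inl)
    have h₂ := hB.dotProduct_mulVec_nonneg (x ∘ Sum.inr)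
    simpa [fromBlocks_mulVec, dotProduct, Fintype.sum_sum_type] using add_nonneg h₁ h₂

/-- The port-Hamiltonian matrices of the guitar FSI model satisfy the three
pH structure properties (pH1) `J = -Jᵀ`, (pH2) `D = Dᵀ ≥ 0`, (pH3) `EᵀQ = QᵀE`. -/
theorem guitar_pH_structure_properties
    (NS NF : ℕ) (hNS : 0 < NS) (hNF : 0 < NF)
    (ρF : ℝ) (hρF : 0 < ρF)
    (MS KS DS : Matrix (Fin NS) (Fin NS) ℝ)
    (MF KF : Matrix (Fin NF) (Fin NF) ℝ)
    (hMS : MS.IsSymm) (hKS : KS.IsSymm) (hDS : DS.IsSymm)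
    (hMF : MF.IsSymm) (hKF : KF.IsSymm)
    (hDSpsd : DS.PosSemidef)
    (R : Matrix (Fin NS) (Fin NF) ℝ) :
    let E : Matrix ((Fin NS ⊕ Fin NF) ⊕ (Fin NS ⊕ Fin NF))
        ((Fin NS ⊕ Fin NF) ⊕ (Fin NS ⊕ Fin NF)) ℝ :=
      fromBlocks (fromBlocks 1 0 0 1) 0 0 (fromBlocks MS 0 0 (ρF⁻¹ • MF))
    let Q : Matrix ((Fin NS ⊕ Fin NF) ⊕ (Fin NS ⊕ Fin NF))
        ((Fin NS ⊕ Fin NF) ⊕ (Fin NS ⊕ Fin NF)) ℝ :=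
      fromBlocks (fromBlocks KS 0 0 KF) 0 0 (fromBlocks 1 0 0 1)
    let D : Matrix ((Fin NS ⊕ Fin NF) ⊕ (Fin NS ⊕ Fin NF))
        ((Fin NS ⊕ Fin NF) ⊕ (Fin NS ⊕ Fin NF)) ℝ :=
      fromBlocks 0 0 0 (fromBlocks DS 0 0 0)
    let J : Matrix ((Fin NS ⊕ Fin NF) ⊕ (Fin NS ⊕ Fin NF))
        ((Fin NS ⊕ Fin NF) ⊕ (Fin NS ⊕ Fin NF)) ℝ :=
      fromBlocks 0 (fromBlocks 1 0 0 1) (fromBlocks (-1) 0 0 (-1))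
        (fromBlocks 0 R (-Rᵀ) 0)
    J = -Jᵀ ∧ (D = Dᵀ ∧ D.PosSemidef) ∧ Eᵀ * Q = Qᵀ * E := by
  intro E Q D J
  refine ⟨?_, ⟨?_, ?_⟩, ?_⟩
  · simp [J, fromBlocks_transpose, fromBlocks_neg, -fromBlocks_one]
  · simp [D, fromBlocks_transpose, hDS.eq]
  · exact posSemidef_fromBlocks_diagonal .zero (posSemidef_fromBlocks_diagonal hDSpsd .zero)
  · simp [E, Q, fromBlocks_transpose, fromBlocks_multiply, hMS.eq, hKS.eq, hMF.eq, hKF.eq]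
end

section
/- Let E, J, D, Q be real N×N matrices with J = −Jᵀ, D = Dᵀ positive semidefinite, and EᵀQ = QᵀE, and let V ∈ ℝ^{N×n}. Define the reduced matrices E_r = Vᵀ Qᵀ E V, J_r = Vᵀ Qᵀ J Q V, D_r = Vᵀ Qᵀ D Q V, and Q_r = I_n (these arise from Petrov–Galerkin projection with W = Q V). Then the reduced matrices again satisfy the port-Hamiltonian structure properties: J_r = −J_rᵀ, D_r = D_rᵀ positive semidefinite, and E_rᵀ Q_r = Q_rᵀ E_r (i.e., E_r is symmetric). Moreover the reduced Hamiltonian coincides with the restriction of the full Hamiltonian: for every x_r ∈ ℝ^n, ½ x_rᵀ E_rᵀ Q_r x_r = ½ (V x_r)ᵀ Eᵀ Q (V x_r). -/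
open Matrix

/-- The pH structure-preserving Petrov–Galerkin projection with `W = QV` yields reduced
matrices `E_r = VᵀQᵀEV`, `J_r = VᵀQᵀJQV`, `D_r = VᵀQᵀDQV`, `Q_r = I` that again satisfy
the pH structure properties, and the reduced Hamiltonian is the restriction of the full one. -/
theorem pH_structure_preserving_reduction
    (N n : ℕ) (E J D Q : Matrix (Fin N) (Fin N) ℝ)
    (hJ : J = -Jᵀ) (hD : D = Dᵀ) (hDpsd : D.PosSemidef)
    (hEQ : Eᵀ * Q = Qᵀ * E)
    (V : Matrix (Fin N) (Fin n) ℝ) :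
    let Er : Matrix (Fin n) (Fin n) ℝ := Vᵀ * Qᵀ * E * V
    let Jr : Matrix (Fin n) (Fin n) ℝ := Vᵀ * Qᵀ * J * Q * V
    let Dr : Matrix (Fin n) (Fin n) ℝ := Vᵀ * Qᵀ * D * Q * V
    let Qr : Matrix (Fin n) (Fin n) ℝ := 1
    Jr = -Jrᵀ ∧ (Dr = Drᵀ ∧ Dr.PosSemidef) ∧ Erᵀ * Qr = Qrᵀ * Er ∧
    ∀ xr : Fin n → ℝ,
      (1 / 2) * (xr ⬝ᵥ (Erᵀ * Qr).mulVec xr) =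
        (1 / 2) * (V.mulVec xr ⬝ᵥ (Eᵀ * Q).mulVec (V.mulVec xr)) := by
  intro Er Jr Dr Qr
  have hErT : Erᵀ = Vᵀ * (Eᵀ * Q) * V := by
    simp [Er, transpose_mul, Matrix.mul_assoc]
  have hEr : Er = Vᵀ * (Eᵀ * Q) * V := by
    simp [Er, hEQ, Matrix.mul_assoc]
  refine ⟨?_, ⟨?_, ?_⟩, ?_, fun xr => ?_⟩
  · have hJt : Jᵀ = -J := by rw [hJ, transpose_neg, transpose_transpose, ← hJ]
    simp [Jr, transpose_mul, Matrix.mul_assoc, hJt]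
  · simp [Dr, transpose_mul, Matrix.mul_assoc, ← hD]
  · simpa [Dr, conjTranspose_eq_transpose_of_trivial, transpose_mul, Matrix.mul_assoc] using
      hDpsd.conjTranspose_mul_mul_same (Q * V)
  · simp only [Qr, Matrix.mul_one, transpose_one, Matrix.one_mul]
    rw [hErT, ← hEr]
  · simp only [Qr, Matrix.mul_one]
    rw [hErT, ← mulVec_mulVec, ← mulVec_mulVec, dotProduct_mulVec, vecMul_transpose]
end

section
/- Let N, m, p, q be natural numbers with p + q ≤ N and 2p + q ≤ m. Let S ∈ ℝ^{2N×2N} with columns s_1, …, s_{2N}, let Q ∈ ℝ^{m×m} be orthogonal, let σ_1, …, σ_p be real numbers, and let D ∈ ℝ^{2N×m} be the sparse matrix whose only nonzero entries are D_{i,i} = σ_i for 1 ≤ i ≤ p, D_{p+j, p+j} = 1 for 1 ≤ j ≤ q, and D_{N+i, p+q+i} = σ_i for 1 ≤ i ≤ p. If X = S D Q, then the squared Frobenius norm of X satisfies ‖X‖_F² = Σ_{i=1}^{p} σ_i² (‖s_i‖² + ‖s_{N+i}‖²) + Σ_{i=p+1}^{p+q} ‖s_i‖², i.e., ‖X‖_F²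 = Σ_{i=1}^{p+q} w_i² where w_i = σ_i √(‖s_i‖² + ‖s_{N+i}‖²) for 1 ≤ i ≤ p and w_i = ‖s_i‖ for p+1 ≤ i ≤ p+q are the weighted symplectic singular values. -/
open Matrix

/-- The squared Frobenius norm of `S * D * Q` when `Q` is orthogonal and the rows of `D` are
pairwise orthogonal. -/
theorem sum_sq_mul_mul_orthogonal {l n m : Type*} [Fintype l] [Fintype n] [Fintype m]
    [DecidableEq n] [DecidableEq m] (S : Matrix l n ℝ) (D : Matrix n m ℝ) (Q : Matrix m m ℝ)
    (hQ : Qᵀ * Q = 1) (d : n → ℝ) (hD : D * Dᵀ = diagonal d) :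
    ∑ i, ∑ j, ((S * D * Q) i j) ^ 2 = ∑ c, d c * ∑ k, (S k c) ^ 2 := by
  have hQ' : Q * Qᵀ = 1 := mul_eq_one_comm.mp hQ
  have key : (S * D * Q) * (S * D * Q)ᵀ = S * diagonal d * Sᵀ := by
    calc (S * D * Q) * (S * D * Q)ᵀ = S * D * (Q * Qᵀ) * Dᵀ * Sᵀ := by
          simp only [transpose_mul, Matrix.mul_assoc]
      _ = S * diagonal d * Sᵀ := by
          rw [hQ', Matrix.mul_one, Matrix.mul_assoc S D, hD]
  calc ∑ i, ∑ j, ((S * D * Q) i j) ^ 2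
      = ∑ i, ((S * D * Q) * (S * D * Q)ᵀ) i i := by
        refine Finset.sum_congr rfl fun i _ => ?_
        rw [mul_apply]
        exact Finset.sum_congr rfl fun j _ => by rw [transpose_apply, sq]
    _ = ∑ i, ∑ c, d c * (S i c) ^ 2 := by
        refine Finset.sum_congr rfl fun i _ => ?_
        rw [key, mul_apply]
        refine Finset.sum_congr rfl fun c _ => ?_
        rw [mul_diagonal, transpose_apply]
        ring
    _ = ∑ c, d c * ∑ k, (S k c) ^ 2 := by
        rw [Finset.sum_comm]
        simp only [Finset.mul_sum]

/-- A matrix with at most one nonzero entry in each row, in pairwise distinct columns, has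
pairwise orthogonal rows. -/
theorem mul_transpose_eq_diagonal_of_sparse {n : Type*} {m : ℕ} [DecidableEq n]
    (D : Matrix n (Fin m) ℝ) (col : n → ℕ) (v : n → ℝ)
    (hD : ∀ a j, D a j = if (j : ℕ) = col a then v a else 0)
    (hcol : ∀ a, v a ≠ 0 → col a < m)
    (hinj : ∀ a b, v a ≠ 0 → v b ≠ 0 → col a = col b → a = b) :
    D * Dᵀ = diagonal fun a => v a ^ 2 := by
  ext a b
  rw [mul_apply]
  simp only [transpose_apply, hD]
  by_cases ha : v a = 0
  · by_cases hab : a = b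
    · subst hab
      simp [ha]
    · simp [ha, diagonal_apply_ne _ hab]
  rw [Finset.sum_eq_single (⟨col a, hcol a ha⟩ : Fin m)]
  · by_cases hab : a = b
    · subst hab
      simp [sq]
    · rw [diagonal_apply_ne _ hab]
      by_cases hb : v b = 0
      · simp [hb]
      · rw [if_neg fun h => hab (hinj a b ha hb h), mul_zero]
  · intro j _ hj
    rw [if_neg fun h => hj (Fin.ext h), zero_mul]
  · simp

/-- Frobenius norm identity for an SVD-like decomposition `X = S D Q`: the squared
Frobenius norm of `X` is the sum of the squared weighted symplectic singular values
`w_i² = σ_i²(‖s_i‖² + ‖s_{N+i}‖²)` for `1 ≤ i ≤ p` and `w_i² = ‖s_i‖²` for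
`p+1 ≤ i ≤ p+q`, where `s_c` denotes the `c`-th column of `S`. -/
theorem svdLike_frobenius_weighted_symplectic_singular_values
    (N m p q : ℕ) (hpqN : p + q ≤ N) (hm : 2 * p + q ≤ m)
    (S : Matrix (Fin N ⊕ Fin N) (Fin N ⊕ Fin N) ℝ)
    (Q : Matrix (Fin m) (Fin m) ℝ) (hQ : Qᵀ * Q = 1)
    (σ : Fin p → ℝ)
    (D : Matrix (Fin N ⊕ Fin N) (Fin m) ℝ)
    (hD : D = Matrix.of (Sum.elim
      (fun (i : Fin N) (j : Fin m) =>
        if h : (i : ℕ) < p then (if (j : ℕ) = (i : ℕ) then σ ⟨i, h⟩ else 0)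
        else if (i : ℕ) < p + q ∧ (j : ℕ) = (i : ℕ) then 1 else 0)
      (fun (i : Fin N) (j : Fin m) =>
        if h : (i : ℕ) < p then (if (j : ℕ) = p + q + (i : ℕ) then σ ⟨i, h⟩ else 0)
        else 0)))
    (X : Matrix (Fin N ⊕ Fin N) (Fin m) ℝ) (hX : X = S * D * Q) :
    let colNormSq : (Fin N ⊕ Fin N) → ℝ := fun c => ∑ k, (S k c) ^ 2
    let w : ℕ → ℝ := fun i =>
      if h : i < p then σ ⟨i, h⟩ *
        Real.sqrt (colNormSq (Sum.inl ⟨i, by omega⟩) + colNormSq (Sum.inr ⟨i, by omega⟩))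
      else if h' : i < p + q then Real.sqrt (colNormSq (Sum.inl ⟨i, by omega⟩))
      else 0
    (∑ i, ∑ j, (X i j) ^ 2 =
      (∑ i : Fin p, σ i ^ 2 *
        (colNormSq (Sum.inl ⟨i, by omega⟩) + colNormSq (Sum.inr ⟨i, by omega⟩))) +
      ∑ i : Fin q, colNormSq (Sum.inl ⟨p + i, by omega⟩)) ∧
    ∑ i, ∑ j, (X i j) ^ 2 = ∑ i ∈ Finset.range (p + q), (w i) ^ 2 := by
  intro colNormSq w
  let v : Fin N ⊕ Fin N → ℝ := Sum.elim
    (fun i => if h : (i : ℕ) < p then σ ⟨i, h⟩ else if (i : ℕ) < p + q then 1 else 0)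
    (fun i => if h : (i : ℕ) < p then σ ⟨i, h⟩ else 0)
  let col : Fin N ⊕ Fin N → ℕ := Sum.elim (fun i => (i : ℕ)) (fun i => p + q + (i : ℕ))
  have hl : ∀ i : Fin N, v (Sum.inl i) ≠ 0 → (i : ℕ) < p + q := by
    intro i hi
    by_contra h
    exact hi (by simp [v, h, show ¬ (i : ℕ) < p by omega])
  have hr : ∀ i : Fin N, v (Sum.inr i) ≠ 0 → (i : ℕ) < p := by
    intro i hi
    by_contra h
    exact hi (by simp [v, h])
  have hDD : D * Dᵀ = diagonal fun a => v a ^ 2 := by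
    refine mul_transpose_eq_diagonal_of_sparse D col v ?_ ?_ ?_
    · rintro (i | i) j
      · simp only [hD, of_apply, Sum.elim_inl, v, col]
        split_ifs <;> first | rfl | omega
      · simp only [hD, of_apply, Sum.elim_inr, v, col]
        split_ifs <;> rfl
    · rintro (i | i) hi
      · have := hl i hi
        simp only [col, Sum.elim_inl]
        omega
      · have := hr i hi
        simp only [col, Sum.elim_inr]
        omega
    · rintro (i | i) (j | j) hi hj h <;> simp only [col, Sum.elim_inl, Sum.elim_inr] at h
      · rw [Fin.ext h]
      · have := hl i hi
        omega
      · have := hl j hj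
        omega
      · rw [Fin.ext (by omega : (i : ℕ) = j)]
  have hnonneg : ∀ c, 0 ≤ colNormSq c := fun c => Finset.sum_nonneg fun k _ => sq_nonneg _
  have hsum : ∑ i, ∑ j, (X i j) ^ 2 =
      (∑ i : Fin p, σ i ^ 2 *
        (colNormSq (Sum.inl ⟨i, by omega⟩) + colNormSq (Sum.inr ⟨i, by omega⟩))) +
      ∑ i : Fin q, colNormSq (Sum.inl ⟨p + i, by omega⟩) := by
    rw [hX, sum_sq_mul_mul_orthogonal S D Q hQ _ hDD]
    change ∑ c, v c ^ 2 * colNormSq c = _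
    clear_value colNormSq
    clear hD hX hDD w
    obtain ⟨r, rfl⟩ := Nat.exists_eq_add_of_le hpqN
    rw [Fintype.sum_sum_type]
    simp only [Fin.sum_univ_add]
    simp only [v, Sum.elim_inl, Sum.elim_inr, Fin.val_castAdd, Fin.val_natAdd, Fin.is_lt,
      dite_true, mul_add, Finset.sum_add_distrib]
    simp [Fin.castAdd, Fin.castLE, Fin.natAdd, add_assoc]
    ring
  refine ⟨hsum, hsum.trans ?_⟩
  rw [Finset.sum_range, Fin.sum_univ_add]
  congr 1
  · refine Finset.sum_congr rfl fun i _ => ?_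
    simp only [w, Fin.val_castAdd, Fin.is_lt, dite_true]
    rw [mul_pow, Real.sq_sqrt (add_nonneg (hnonneg _) (hnonneg _))]
  · refine Finset.sum_congr rfl fun i _ => ?_
    have h1 : ¬ p + (i : ℕ) < p := by omega
    have h2 : p + (i : ℕ) < p + q := by omega
    simp only [w, Fin.val_natAdd, h1, h2, dite_true, dite_false]
    rw [Real.sq_sqrt (hnonneg _)]
end

section
/- Let E, J, D, Q be real N×N matrices with J = −Jᵀ, D = Dᵀ positive semidefinite, and EᵀQ = QᵀE, let B ∈ ℝ^{N×m}, Δt > 0, u ∈ ℝ^m, and let x, x⁺ ∈ ℝ^N satisfy one step of the implicit midpoint rule E (x⁺ − x) = Δt [ (J − D) Q m + B u ] with midpoint m = (x + x⁺)/2. Then, with H(ξ) = ½ ξᵀ Eᵀ Q ξ and midpoint output y_m = Bᵀ Q m, the discrete energy balance H(x⁺) − H(x) = Δt ( ⟨y_m, u⟩ − (Q m)ᵀ D (Q m) ) holds; in particular H(x⁺) − H(x) ≤ Δt ⟨y_m, u⟩, and if D = 0 and u = 0 the implicit midpoint rule exactly conserves the Hamiltonian: H(x⁺) = H(x). -/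
open Matrix

/-- The quadratic form of a skew-symmetric real matrix vanishes. -/
theorem dotProduct_mulVec_self_eq_zero_of_skew {n : Type*} [Fintype n] {J : Matrix n n ℝ}
    (hJ : J = -Jᵀ) (v : n → ℝ) : v ⬝ᵥ J *ᵥ v = 0 := by
  have h : v ⬝ᵥ J *ᵥ v = -(v ⬝ᵥ J *ᵥ v) := by
    conv_lhs => rw [hJ, neg_mulVec, dotProduct_neg, dotProduct_transpose_mulVec]
  linarith

/-- The increment of a symmetric quadratic form is its bilinear form evaluated at the sum and
the difference of the two points. -/
theorem dotProduct_mulVec_sub_of_isSymm {n : Type*} [Fintype n] {A : Matrix n n ℝ}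
    (hA : A.IsSymm) (x y : n → ℝ) :
    y ⬝ᵥ A *ᵥ y - x ⬝ᵥ A *ᵥ x = (y - x) ⬝ᵥ A *ᵥ (x + y) := by
  have h : x ⬝ᵥ A *ᵥ y = y ⬝ᵥ A *ᵥ x := by
    conv_lhs => rw [← hA.eq, dotProduct_transpose_mulVec]
  rw [mulVec_add, dotProduct_add, sub_dotProduct, sub_dotProduct, h]
  ring

/-- Discrete energy balance of the implicit midpoint rule for a linear port-Hamiltonian
descriptor system: `H(x⁺) − H(x) = Δt(⟨y_m, u⟩ − (Qm)ᵀD(Qm)) ≤ Δt⟨y_m, u⟩`, with exact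
Hamiltonian conservation when `D = 0` and `u = 0`. -/
theorem implicit_midpoint_discrete_energy_balance
    (N m : ℕ) (E J D Q : Matrix (Fin N) (Fin N) ℝ)
    (hJ : J = -Jᵀ) (hD : D = Dᵀ) (hDpsd : D.PosSemidef)
    (hEQ : Eᵀ * Q = Qᵀ * E)
    (B : Matrix (Fin N) (Fin m) ℝ)
    (Δt : ℝ) (hΔt : 0 < Δt) (u : Fin m → ℝ)
    (x xp : Fin N → ℝ)
    (hstep : E.mulVec (xp - x) =
      Δt • (((J - D) * Q).mulVec ((1 / 2 : ℝ) • (x + xp)) + B.mulVec u)) :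
    let H : (Fin N → ℝ) → ℝ := fun ξ => (1 / 2) * (ξ ⬝ᵥ (Eᵀ * Q).mulVec ξ)
    let mid : Fin N → ℝ := (1 / 2 : ℝ) • (x + xp)
    let ym : Fin m → ℝ := (Bᵀ * Q).mulVec mid
    H xp - H x = Δt * (ym ⬝ᵥ u - (Q.mulVec mid) ⬝ᵥ D.mulVec (Q.mulVec mid)) ∧
    H xp - H x ≤ Δt * (ym ⬝ᵥ u) ∧
    (D = 0 → u = 0 → H xp = H x) := by
  intro H mid ym
  have hsymm : (Eᵀ * Q).IsSymm := by
    rw [IsSymm, transpose_mul, transpose_transpose, hEQ]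
  have hincr : H xp - H x = E *ᵥ (xp - x) ⬝ᵥ Q *ᵥ mid := by
    calc H xp - H x = (1 / 2) * ((xp - x) ⬝ᵥ (Eᵀ * Q) *ᵥ (x + xp)) := by
          rw [← dotProduct_mulVec_sub_of_isSymm hsymm, mul_sub]
      _ = (xp - x) ⬝ᵥ (Eᵀ * Q) *ᵥ mid := by
          simp only [mid, mulVec_smul, dotProduct_smul, smul_eq_mul]
      _ = E *ᵥ (xp - x) ⬝ᵥ Q *ᵥ mid := by
          rw [← mulVec_mulVec, dotProduct_transpose_mulVec, dotProduct_comm]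
  have hport : B *ᵥ u ⬝ᵥ Q *ᵥ mid = ym ⬝ᵥ u := by
    simp only [ym]
    rw [← mulVec_mulVec, dotProduct_comm _ u, dotProduct_transpose_mulVec, dotProduct_comm]
  have hbalance : H xp - H x = Δt * (ym ⬝ᵥ u - (Q *ᵥ mid) ⬝ᵥ D *ᵥ (Q *ᵥ mid)) := by
    rw [hincr, hstep, smul_dotProduct, add_dotProduct, hport, ← mulVec_mulVec, sub_mulVec,
      dotProduct_comm _ (Q *ᵥ mid), dotProduct_sub, dotProduct_mulVec_self_eq_zero_of_skew hJ,
      smul_eq_mul]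
    ring
  refine ⟨hbalance, ?_, ?_⟩
  · have hdiss : 0 ≤ (Q *ᵥ mid) ⬝ᵥ D *ᵥ (Q *ᵥ mid) := by
      simpa using hDpsd.dotProduct_mulVec_nonneg (Q *ᵥ mid)
    rw [hbalance]
    exact mul_le_mul_of_nonneg_left (sub_le_self _ hdiss) hΔt.le
  · rintro hD0 hu0
    rw [← sub_eq_zero, hbalance, hD0, hu0]
    simp
end
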